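/- arXiv:1012.0342 — 2 statements merged into one kernel-verified Lean document; each statement's English description precedes it below -/
import Mathlib

section
/- Let n ≥ 3 and let (A,B) be an admissible Sobolev pair for ℝⁿ with q > n, q ≥ 2. Then there exists a constant C (depending only on n and q) such that every smooth compactly supported u : ℝⁿ → ℝ satisfies ‖u‖_∞ ≤ C · ‖u‖_2^{1−α} · (A‖∇u‖_q + B‖u‖_q)^{α}, where α := (1/2)/(1/2 − 1/q + 1/n) ∈ (0,1). -/
open MeasureTheory

/-- The `L^p` norm (with respect to Lebesgue measure) of a function on `ℝⁿ`. -/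
noncomputable def lpN (n : ℕ) (p : ℝ) (u : EuclideanSpace ℝ (Fin n) → ℝ) : ℝ :=
  (eLpNorm u (ENNReal.ofReal p) volume).toReal

/-- The `L^p` norm of the pointwise norm of the `k`-th iterated derivative. -/
noncomputable def dLpN (n k : ℕ) (p : ℝ) (u : EuclideanSpace ℝ (Fin n) → ℝ) : ℝ :=
  (eLpNorm (fun x => ‖iteratedFDeriv ℝ k u x‖) (ENNReal.ofReal p) volume).toReal

/-- `(A, B)` is an admissible Sobolev pair for `ℝⁿ`: both are positive and the
Sobolev inequality `‖u‖_{2n/(n-2)} ≤ A ‖∇u‖₂ + B ‖u‖₂` holds for all smooth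
compactly supported functions. -/
def SobolevPair (n : ℕ) (A B : ℝ) : Prop :=
  0 < A ∧ 0 < B ∧
    ∀ u : EuclideanSpace ℝ (Fin n) → ℝ, ContDiff ℝ (⊤ : ℕ∞) u → HasCompactSupport u →
      lpN n (2 * (n : ℝ) / ((n : ℝ) - 2)) u ≤ A * dLpN n 1 2 u + B * lpN n 2 u

/-- The `L^∞` norm (essential supremum) of a function on `ℝⁿ`. -/
noncomputable def lpTopN (n : ℕ) (u : EuclideanSpace ℝ (Fin n) → ℝ) : ℝ :=
  (eLpNorm u ⊤ volume).toReal

open Module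

theorem eLpNorm_comp_add_smul {E F : Type*} [NormedAddCommGroup E] [NormedSpace ℝ E]
    [FiniteDimensional ℝ E] [MeasurableSpace E] [BorelSpace E] (μ : Measure E)
    [μ.IsAddHaarMeasure] [NormedAddCommGroup F] {f : E → F} (hf : Continuous f)
    {p s : ℝ} (hp : 0 < p) (hs : 0 < s) (x : E) :
    eLpNorm (fun y => f (x + s • y)) (ENNReal.ofReal p) μ =
      ENNReal.ofReal (s ^ (-(finrank ℝ E / p))) * eLpNorm f (ENNReal.ofReal p) μ := by
  have hg : Continuous fun z => f (x + z) := by fun_prop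
  have h1 := eLpNorm_map_measure (p := ENNReal.ofReal p) (μ := μ)
    (f := fun y : E => s • y) (g := fun z => f (x + z))
    hg.aestronglyMeasurable (by fun_prop)
  have h2 := eLpNorm_comp_measurePreserving (p := ENNReal.ofReal p) (μ := μ) (ν := μ)
    (g := f) hf.aestronglyMeasurable (measurePreserving_add_left μ x)
  rw [Measure.map_addHaar_smul μ hs.ne', eLpNorm_smul_measure_of_ne_top ENNReal.ofReal_ne_top] at h1
  simp only [Function.comp_def] at h1 h2
  rw [← h1, h2, smul_eq_mul, abs_of_pos (by positivity),
    ENNReal.ofReal_rpow_of_pos (by positivity)]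
  congr 2
  rw [one_div, ENNReal.toReal_inv, ENNReal.toReal_ofReal hp.le, ← Real.rpow_natCast,
    ← Real.rpow_neg hs.le, ← Real.rpow_mul hs.le]
  congr 1
  ring

theorem setLIntegral_enorm_comp_add_smul_le {E F : Type*} [NormedAddCommGroup E] [NormedSpace ℝ E]
    [FiniteDimensional ℝ E] [MeasurableSpace E] [BorelSpace E] (μ : Measure E)
    [μ.IsAddHaarMeasure] [NormedAddCommGroup F] {f : E → F} (hf : Continuous f)
    {p s : ℝ} (hp : 1 ≤ p) (hs : 0 < s) (x : E) (t : Set E) :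
    ∫⁻ y in t, ‖f (x + s • y)‖ₑ ∂μ ≤
      ENNReal.ofReal (s ^ (-(finrank ℝ E / p))) * eLpNorm f (ENNReal.ofReal p) μ *
        μ t ^ (1 - 1 / p) := by
  have hg : Continuous fun y => f (x + s • y) := by fun_prop
  have h := eLpNorm_le_eLpNorm_mul_rpow_measure_univ (μ := μ.restrict t)
    (p := 1) (q := ENNReal.ofReal p) (by simpa using hp) hg.aestronglyMeasurable
  rw [eLpNorm_one_eq_lintegral_enorm, ENNReal.toReal_ofReal (by linarith)] at h
  simp only [Measure.restrict_apply_univ, ENNReal.toReal_one, div_one] at h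
  refine h.trans ?_
  gcongr
  rw [← eLpNorm_comp_add_smul μ hf (by linarith) hs x]
  exact eLpNorm_mono_measure _ Measure.restrict_le_self

theorem enorm_sub_le_lintegral_fderiv {E : Type*} [NormedAddCommGroup E] [NormedSpace ℝ E]
    {u : E → ℝ} (hu : ContDiff ℝ 1 u) (x y : E) :
    ‖u (x + y) - u x‖ₑ ≤ ∫⁻ t in Set.Ioc (0 : ℝ) 1, ‖fderiv ℝ u (x + t • y)‖ₑ * ‖y‖ₑ := by
  have hd : ∀ t : ℝ, HasDerivAt (fun t : ℝ => u (x + t • y)) (fderiv ℝ u (x + t • y) y) t := by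
    intro t
    have h1 := ((hu.differentiable one_ne_zero) (x + t • y)).hasFDerivAt
    have h2 : HasDerivAt (fun t : ℝ => x + t • y) y t := by
      simpa using ((hasDerivAt_id t).smul_const y).const_add x
    exact h1.comp_hasDerivAt t h2
  have hc : Continuous fun t : ℝ => fderiv ℝ u (x + t • y) y := by
    have := hu.continuous_fderiv one_ne_zero
    fun_prop
  have h := intervalIntegral.integral_eq_sub_of_hasDerivAt (fun t _ => hd t)
    (hc.intervalIntegrable 0 1)
  simp only [one_smul, zero_smul, add_zero] at h
  rw [← h, intervalIntegral.integral_of_le zero_le_one]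
  refine (enorm_integral_le_lintegral_enorm _).trans (lintegral_mono fun t => ?_)
  exact ContinuousLinearMap.le_opENorm _ _

theorem measure_ball_mul_enorm_le {E : Type*} [NormedAddCommGroup E] [NormedSpace ℝ E]
    [FiniteDimensional ℝ E] [MeasurableSpace E] [BorelSpace E] (μ : Measure E)
    [μ.IsAddHaarMeasure] {u : E → ℝ} (hu : ContDiff ℝ 1 u) {p q r : ℝ} (hp : 1 ≤ p) (hq : 1 ≤ q)
    (hr : 0 < r) (x : E) :
    μ (Metric.ball 0 1) * ‖u x‖ₑ ≤
      ENNReal.ofReal (r ^ (-(finrank ℝ E / p))) * eLpNorm u (ENNReal.ofReal p) μ *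
        μ (Metric.ball 0 1) ^ (1 - 1 / p) +
      ENNReal.ofReal (r ^ (1 - finrank ℝ E / q)) * eLpNorm (fderiv ℝ u) (ENNReal.ofReal q) μ *
        (μ (Metric.ball 0 1) ^ (1 - 1 / q) *
          ∫⁻ t in Set.Ioc (0 : ℝ) 1, ENNReal.ofReal (t ^ (-(finrank ℝ E / q)))) := by
  have hdu : Continuous (fderiv ℝ u) := hu.continuous_fderiv one_ne_zero
  have hcu : Continuous u := hu.continuous
  set b := Metric.ball (0 : E) 1
  have hpt : ∀ y ∈ b, ‖u x‖ₑ ≤ ‖u (x + r • y)‖ₑ +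
      ∫⁻ t in Set.Ioc (0 : ℝ) 1, ENNReal.ofReal r * ‖fderiv ℝ u (x + (r * t) • y)‖ₑ := by
    intro y hy
    have hy1 : ‖y‖ ≤ 1 := (mem_ball_zero_iff.mp hy).le
    have h1 : ‖u x‖ₑ ≤ ‖u (x + r • y)‖ₑ + ‖u (x + r • y) - u x‖ₑ := by
      have := enorm_sub_le (a := u (x + r • y)) (b := u (x + r • y) - u x)
      simpa using this
    refine h1.trans (add_le_add le_rfl ?_)
    refine (enorm_sub_le_lintegral_fderiv hu x (r • y)).trans (lintegral_mono fun t => ?_)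
    rw [mul_comm, smul_smul, mul_comm t r]
    gcongr
    rw [← ofReal_norm, norm_smul, Real.norm_of_nonneg hr.le]
    exact ENNReal.ofReal_le_ofReal (mul_le_of_le_one_right hr.le hy1)
  calc μ b * ‖u x‖ₑ = ∫⁻ y in b, ‖u x‖ₑ ∂μ := by simp [mul_comm]
    _ ≤ ∫⁻ y in b, (‖u (x + r • y)‖ₑ +
          ∫⁻ t in Set.Ioc (0 : ℝ) 1, ENNReal.ofReal r * ‖fderiv ℝ u (x + (r * t) • y)‖ₑ) ∂μ :=
        setLIntegral_mono' measurableSet_ball hpt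
    _ = ∫⁻ y in b, ‖u (x + r • y)‖ₑ ∂μ +
          ∫⁻ t in Set.Ioc (0 : ℝ) 1, ∫⁻ y in b,
            ENNReal.ofReal r * ‖fderiv ℝ u (x + (r * t) • y)‖ₑ ∂μ := by
        rw [lintegral_add_left (by fun_prop : Continuous fun y => ‖u (x + r • y)‖ₑ).measurable,
          lintegral_lintegral_swap]
        refine Measurable.aemeasurable (Continuous.measurable ?_)
        simp only [Function.uncurry_def]
        refine (ENNReal.continuous_const_mul ENNReal.ofReal_ne_top).comp ?_
        fun_prop
    _ ≤ _ := by
        refine add_le_add (setLIntegral_enorm_comp_add_smul_le μ hcu hp hr x b) ?_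
        rw [← lintegral_const_mul _ (by fun_prop), ← lintegral_const_mul _ (by fun_prop)]
        refine setLIntegral_mono' measurableSet_Ioc fun t ht => ?_
        rw [lintegral_const_mul _ (by fun_prop)]
        refine (mul_le_mul_right (setLIntegral_enorm_comp_add_smul_le μ hdu hq
          (mul_pos hr ht.1) x b) _).trans_eq ?_
        have e : r ^ (1 - finrank ℝ E / q) = r * r ^ (-(finrank ℝ E / q)) := by
          rw [sub_eq_add_neg, Real.rpow_add hr, Real.rpow_one]
        rw [Real.mul_rpow hr.le ht.1.le, e, ENNReal.ofReal_mul (by positivity),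
          ENNReal.ofReal_mul (by positivity)]
        ring

theorem lintegral_Ioc_rpow_ne_top {a : ℝ} (ha : a < 1) :
    ∫⁻ t in Set.Ioc (0 : ℝ) 1, ENNReal.ofReal (t ^ (-a)) ≠ ⊤ := by
  have h := intervalIntegral.intervalIntegrable_rpow' (a := 0) (b := 1) (r := -a) (by linarith)
  rw [intervalIntegrable_iff_integrableOn_Ioc_of_le zero_le_one] at h
  exact h.lintegral_lt_top.ne

theorem le_of_forall_rpow_le {M K L a b P Q : ℝ} (ha : 0 < a) (hb : 0 < b) (hL : 0 ≤ L) (hK : 0 ≤ K)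
    (h : ∀ r : ℝ, 0 < r → M ≤ r ^ (-a) * L * P + r ^ b * K * Q) :
    M ≤ (P + Q) * L ^ (1 - a / (a + b)) * K ^ (a / (a + b)) := by
  have hab : 0 < a + b := by positivity
  have e1 : 1 - a / (a + b) = b / (a + b) := by field_simp; ring
  rcases hL.eq_or_lt with rfl | hL
  · rw [e1, Real.zero_rpow (by positivity)]
    have ht : Filter.Tendsto (fun r : ℝ => r ^ b * K * Q) (nhdsWithin 0 (Set.Ioi 0)) (nhds 0) := by
      have := (((Real.continuousAt_rpow_const 0 b (Or.inr hb.le)).tendsto.mono_left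
        (nhdsWithin_le_nhds (s := Set.Ioi 0))).mul_const K).mul_const Q
      simpa [Real.zero_rpow hb.ne'] using this
    simp only [mul_zero, zero_mul]
    refine ge_of_tendsto ht ?_
    filter_upwards [self_mem_nhdsWithin] with r hr
    simpa using h r hr
  rcases hK.eq_or_lt with rfl | hK
  · rw [Real.zero_rpow (by positivity)]
    have ht : Filter.Tendsto (fun r : ℝ => r ^ (-a) * L * P) Filter.atTop (nhds 0) := by
      simpa using ((tendsto_rpow_neg_atTop ha).mul_const L).mul_const P
    simp only [mul_zero]
    refine ge_of_tendsto ht ?_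
    filter_upwards [Filter.eventually_gt_atTop 0] with r hr
    simpa using h r hr
  · refine (h ((L / K) ^ (1 / (a + b))) (by positivity)).trans_eq ?_
    have hL1 : L ^ (1 - a / (a + b)) = L ^ (-(a / (a + b))) * L := by
      rw [sub_eq_neg_add, Real.rpow_add hL, Real.rpow_one]
    have hK1 : K ^ (a / (a + b)) = K ^ (-(b / (a + b))) * K := by
      rw [show a / (a + b) = -(b / (a + b)) + 1 by field_simp; ring, Real.rpow_add hK,
        Real.rpow_one]
    have f1 : ((L / K) ^ (1 / (a + b))) ^ (-a) * L = L ^ (1 - a / (a + b)) * K ^ (a / (a + b)) := by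
      rw [← Real.rpow_mul (by positivity), show 1 / (a + b) * -a = -(a / (a + b)) by ring,
        Real.div_rpow hL.le hK.le, Real.rpow_neg hK.le, hL1]
      field_simp
    have f2 : ((L / K) ^ (1 / (a + b))) ^ b * K = L ^ (1 - a / (a + b)) * K ^ (a / (a + b)) := by
      rw [← Real.rpow_mul (by positivity), show 1 / (a + b) * b = b / (a + b) by ring,
        Real.div_rpow hL.le hK.le, e1, hK1, Real.rpow_neg hK.le]
      field_simp
    rw [f1, f2]
    ring

theorem exists_norm_le_eLpNorm_rpow_mul_fderiv_rpow {E : Type*} [NormedAddCommGroup E]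
    [NormedSpace ℝ E] [FiniteDimensional ℝ E] [Nontrivial E] [MeasurableSpace E] [BorelSpace E]
    (μ : Measure E) [μ.IsAddHaarMeasure] {p q : ℝ} (hp : 1 ≤ p) (hq : finrank ℝ E < q) :
    ∃ C : ℝ, 0 ≤ C ∧ ∀ u : E → ℝ, ContDiff ℝ 1 u → HasCompactSupport u → ∀ x,
      ‖u x‖ ≤ C * (eLpNorm u (ENNReal.ofReal p) μ).toReal ^
          (1 - (finrank ℝ E / p) / (finrank ℝ E / p + (1 - finrank ℝ E / q))) *
        (eLpNorm (fderiv ℝ u) (ENNReal.ofReal q) μ).toReal ^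
          ((finrank ℝ E / p) / (finrank ℝ E / p + (1 - finrank ℝ E / q))) := by
  have hd : (1 : ℝ) ≤ finrank ℝ E := by exact_mod_cast (finrank_pos (R := ℝ) (M := E))
  have hdq : finrank ℝ E / q < 1 := (div_lt_one (by linarith)).mpr hq
  set m := μ (Metric.ball (0 : E) 1) with hm
  have hm0 : m ≠ 0 := (Metric.measure_ball_pos μ 0 one_pos).ne'
  have hmt : m ≠ ⊤ := measure_ball_lt_top.ne
  have hmpos : 0 < m.toReal := ENNReal.toReal_pos hm0 hmt
  set I := ∫⁻ t in Set.Ioc (0 : ℝ) 1, ENNReal.ofReal (t ^ (-(finrank ℝ E / q))) with hI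
  have hIt : I ≠ ⊤ := lintegral_Ioc_rpow_ne_top hdq
  have hmp (c : ℝ) : m ^ c ≠ ⊤ := ENNReal.rpow_ne_top_of_ne_zero hm0 hmt
  refine ⟨(m ^ (1 - 1 / p)).toReal / m.toReal + (m ^ (1 - 1 / q) * I).toReal / m.toReal,
    by positivity, fun u hu hsupp x => ?_⟩
  refine le_of_forall_rpow_le (by positivity) (by linarith) ENNReal.toReal_nonneg
    ENNReal.toReal_nonneg fun r hr => ?_
  have h := measure_ball_mul_enorm_le μ hu hp (by linarith : 1 ≤ q) hr x
  rw [← hm, ← hI] at h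
  have hL : eLpNorm u (ENNReal.ofReal p) μ ≠ ⊤ :=
    (hu.continuous.memLp_of_hasCompactSupport hsupp).eLpNorm_ne_top
  have hG : eLpNorm (fderiv ℝ u) (ENNReal.ofReal q) μ ≠ ⊤ :=
    ((hu.continuous_fderiv one_ne_zero).memLp_of_hasCompactSupport
      (hsupp.fderiv (𝕜 := ℝ))).eLpNorm_ne_top
  have h1 := ENNReal.mul_ne_top
    (ENNReal.mul_ne_top (ENNReal.ofReal_ne_top (r := r ^ (-(finrank ℝ E / p)))) hL)
    (hmp (1 - 1 / p))
  have h2 := ENNReal.mul_ne_top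
    (ENNReal.mul_ne_top (ENNReal.ofReal_ne_top (r := r ^ (1 - finrank ℝ E / q))) hG)
    (ENNReal.mul_ne_top (hmp (1 - 1 / q)) hIt)
  have h3 := ENNReal.toReal_mono (ENNReal.add_ne_top.mpr ⟨h1, h2⟩) h
  rw [ENNReal.toReal_add h1 h2, ENNReal.toReal_mul, toReal_enorm, ENNReal.toReal_mul,
    ENNReal.toReal_mul, ENNReal.toReal_mul (b := _ * I), ENNReal.toReal_mul,
    ENNReal.toReal_ofReal (by positivity), ENNReal.toReal_ofReal (by positivity)] at h3
  rw [← mul_div_assoc, ← mul_div_assoc, ← add_div, le_div_iff₀ hmpos, mul_comm]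
  exact h3

theorem dLpN_one (n : ℕ) (p : ℝ) (u : EuclideanSpace ℝ (Fin n) → ℝ) :
    dLpN n 1 p u = (eLpNorm (fderiv ℝ u) (ENNReal.ofReal p) volume).toReal := by
  simp only [dLpN, norm_iteratedFDeriv_one, eLpNorm_norm]

theorem lpN_comp_smul {n : ℕ} {u : EuclideanSpace ℝ (Fin n) → ℝ} (hu : Continuous u)
    {p s : ℝ} (hp : 0 < p) (hs : 0 < s) :
    lpN n p (fun y => u (s • y)) = s ^ (-(n / p)) * lpN n p u := by
  have h := eLpNorm_comp_add_smul volume hu hp hs 0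
  simp only [zero_add, finrank_euclideanSpace_fin] at h
  rw [lpN, h, ENNReal.toReal_mul, ENNReal.toReal_ofReal (by positivity), lpN]

theorem dLpN_one_comp_smul {n : ℕ} {u : EuclideanSpace ℝ (Fin n) → ℝ} (hu : ContDiff ℝ 1 u)
    {p s : ℝ} (hp : 0 < p) (hs : 0 < s) :
    dLpN n 1 p (fun y => u (s • y)) = s * (s ^ (-(n / p)) * dLpN n 1 p u) := by
  have h := eLpNorm_comp_add_smul volume (hu.continuous_fderiv one_ne_zero) hp hs 0
  simp only [zero_add, finrank_euclideanSpace_fin] at h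
  have hd : fderiv ℝ (fun y => u (s • y)) = s • fun y => fderiv ℝ u (s • y) := by
    ext1 y
    exact fderiv_comp_smul s
  have hsmul := eLpNorm_const_smul s (fun y => fderiv ℝ u (s • y)) (ENNReal.ofReal p) volume
  rw [dLpN_one, hd, hsmul, h, ENNReal.toReal_mul, ENNReal.toReal_mul,
    ENNReal.toReal_ofReal (by positivity), toReal_enorm, Real.norm_of_nonneg hs.le, dLpN_one]

/-- Concentrating a test function makes the zeroth-order term of the Sobolev inequality
negligible. -/
theorem SobolevPair.lpN_le {n : ℕ} (hn : 3 ≤ n) {A B : ℝ} (h : SobolevPair n A B)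
    {u : EuclideanSpace ℝ (Fin n) → ℝ} (hu : ContDiff ℝ (⊤ : ℕ∞) u) (hsupp : HasCompactSupport u) :
    lpN n (2 * (n : ℝ) / ((n : ℝ) - 2)) u ≤ A * dLpN n 1 2 u := by
  have hn' : (3 : ℝ) ≤ n := by exact_mod_cast hn
  have hn2 : (0 : ℝ) < n - 2 := by linarith
  have hpos : 0 < 2 * (n : ℝ) / ((n : ℝ) - 2) := by positivity
  have hs : ∀ s : ℝ, 0 < s → lpN n (2 * (n : ℝ) / ((n : ℝ) - 2)) u ≤
      A * dLpN n 1 2 u + B * lpN n 2 u * s⁻¹ := by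
    intro s hs
    have h1 := h.2.2 (fun y => u (s • y)) (by fun_prop)
      (hsupp.comp_homeomorph (Homeomorph.smulOfNeZero s hs.ne'))
    rw [lpN_comp_smul hu.continuous hpos hs, lpN_comp_smul hu.continuous two_pos hs,
      dLpN_one_comp_smul (hu.of_le (by simp)) two_pos hs,
      show -((n : ℝ) / (2 * n / (n - 2))) = 1 + -(n / 2) by field_simp; ring,
      Real.rpow_add hs, Real.rpow_one] at h1
    have ht : 0 < s * s ^ (-((n : ℝ) / 2)) := by positivity
    refine le_of_mul_le_mul_left (h1.trans_eq ?_) ht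
    field_simp
  have ht : Filter.Tendsto (fun s : ℝ => A * dLpN n 1 2 u + B * lpN n 2 u * s⁻¹) Filter.atTop
      (nhds (A * dLpN n 1 2 u)) := by
    simpa using (tendsto_inv_atTop_zero.const_mul (B * lpN n 2 u)).const_add (A * dLpN n 1 2 u)
  refine ge_of_tendsto ht ?_
  filter_upwards [Filter.eventually_gt_atTop 0] with s h0 using hs s h0

theorem exists_pos_le_of_sobolevPair {n : ℕ} (hn : 3 ≤ n) :
    ∃ c : ℝ, 0 < c ∧ ∀ A B : ℝ, SobolevPair n A B → c ≤ A := by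
  have hn' : (3 : ℝ) ≤ n := by exact_mod_cast hn
  let f : ContDiffBump (0 : EuclideanSpace ℝ (Fin n)) := default
  have hp : 0 < 2 * (n : ℝ) / ((n : ℝ) - 2) := div_pos (by linarith) (by linarith)
  have ha : 0 < lpN n (2 * (n : ℝ) / ((n : ℝ) - 2)) f := by
    refine ENNReal.toReal_pos (fun h0 => ?_)
      (f.continuous.memLp_of_hasCompactSupport f.hasCompactSupport).eLpNorm_ne_top
    rw [eLpNorm_eq_zero_iff f.continuous.aestronglyMeasurable (by simpa using hp),
      f.continuous.ae_eq_iff_eq volume continuous_zero] at h0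
    have h1 := f.one_of_mem_closedBall (Metric.mem_closedBall_self f.rIn_pos.le)
    rw [h0] at h1
    simp at h1
  have hle : ∀ A B : ℝ, SobolevPair n A B →
      lpN n (2 * (n : ℝ) / ((n : ℝ) - 2)) f ≤ A * dLpN n 1 2 f := fun A B h =>
    h.lpN_le hn f.contDiff f.hasCompactSupport
  have hb : 0 ≤ dLpN n 1 2 f := ENNReal.toReal_nonneg
  rcases hb.eq_or_lt with hb | hb
  · refine ⟨1, one_pos, fun A B h => ?_⟩
    have := hle A B h
    rw [← hb, mul_zero] at this
    linarith
  · exact ⟨_, div_pos ha hb, fun A B h => (div_le_iff₀ hb).mpr (hle A B h)⟩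

theorem stmt10 (n : ℕ) (hn : 3 ≤ n) (q : ℝ) (hq2 : 2 ≤ q) (hqn : (n : ℝ) < q) :
    0 < (1 / 2) / (1 / 2 - 1 / q + 1 / (n : ℝ)) ∧
    (1 / 2) / (1 / 2 - 1 / q + 1 / (n : ℝ)) < 1 ∧
    ∃ C : ℝ, ∀ A B : ℝ, SobolevPair n A B →
      ∀ u : EuclideanSpace ℝ (Fin n) → ℝ, ContDiff ℝ (⊤ : ℕ∞) u → HasCompactSupport u →
        lpTopN n u ≤
          C * (lpN n 2 u) ^ (1 - (1 / 2) / (1 / 2 - 1 / q + 1 / (n : ℝ))) *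
            (A * dLpN n 1 q u + B * lpN n q u) ^ ((1 / 2) / (1 / 2 - 1 / q + 1 / (n : ℝ))) := by
  have hn' : (3 : ℝ) ≤ n := by exact_mod_cast hn
  have hinv : 1 / q < 1 / (n : ℝ) := one_div_lt_one_div_of_lt (by linarith) hqn
  refine ⟨by apply div_pos <;> linarith, (div_lt_one (by linarith)).mpr (by linarith), ?_⟩
  have : Nontrivial (EuclideanSpace ℝ (Fin n)) :=
    Module.nontrivial_of_finrank_pos (R := ℝ) (by rw [finrank_euclideanSpace_fin]; omega)
  obtain ⟨K, hK0, hK⟩ := exists_norm_le_eLpNorm_rpow_mul_fderiv_rpow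
    (volume : Measure (EuclideanSpace ℝ (Fin n))) one_le_two
    (by rwa [finrank_euclideanSpace_fin] : (finrank ℝ (EuclideanSpace ℝ (Fin n)) : ℝ) < q)
  obtain ⟨c, hc, hcA⟩ := exists_pos_le_of_sobolevPair hn
  have hα : (n / 2 : ℝ) / (n / 2 + (1 - n / q)) = (1 / 2) / (1 / 2 - 1 / q + 1 / (n : ℝ)) := by
    rw [show (n / 2 : ℝ) = n * (1 / 2) by ring,
      show n * (1 / 2) + (1 - n / q) = n * (1 / 2 - 1 / q + 1 / (n : ℝ)) by field_simp; ring,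
      mul_div_mul_left _ _ (by positivity)]
  simp only [finrank_euclideanSpace_fin, hα, ← dLpN_one] at hK
  have hα0 : 0 < (1 / 2) / (1 / 2 - 1 / q + 1 / (n : ℝ)) := by apply div_pos <;> linarith
  set α := (1 / 2) / (1 / 2 - 1 / q + 1 / (n : ℝ))
  refine ⟨K * c⁻¹ ^ α, fun A B hAB u hu hsupp => ?_⟩
  have hG : 0 ≤ dLpN n 1 q u := ENNReal.toReal_nonneg
  have hLq : 0 ≤ lpN n q u := ENNReal.toReal_nonneg
  have hL : 0 ≤ lpN n 2 u := ENNReal.toReal_nonneg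
  have hA := hAB.1
  have hB := hAB.2.1
  have hbound : dLpN n 1 q u ≤ c⁻¹ * (A * dLpN n 1 q u + B * lpN n q u) := by
    rw [inv_mul_eq_div, le_div_iff₀ hc, mul_comm]
    exact (mul_le_mul_of_nonneg_right (hcA A B hAB) hG).trans
      (le_add_of_nonneg_right (by positivity))
  have hsup : lpTopN n u ≤ K * lpN n 2 u ^ (1 - α) * dLpN n 1 q u ^ α := by
    refine ENNReal.toReal_le_of_le_ofReal (by positivity) ?_
    rw [eLpNorm_exponent_top]
    exact eLpNormEssSup_le_of_ae_bound (.of_forall (hK u (hu.of_le (by simp)) hsupp))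
  calc lpTopN n u ≤ K * lpN n 2 u ^ (1 - α) * dLpN n 1 q u ^ α := hsup
    _ ≤ K * lpN n 2 u ^ (1 - α) * (c⁻¹ * (A * dLpN n 1 q u + B * lpN n q u)) ^ α := by gcongr
    _ = _ := by
      rw [Real.mul_rpow (by positivity) (by positivity)]
      ring
end

section
/- Let n ≥ 1, let m be a positive integer, and let α, β ∈ (0,1]. There exists a constant C depending only on n, m, α, β such that for every smooth compactly supported u : ℝⁿ → ℝ and every integer 0 ≤ k ≤ m: ‖∇ᵏu‖_{1/γ_k} ≤ C · ‖u‖_{1/α}^{1−k/m} · ‖∇ᵐu‖_{1/β}^{k/m}, where γ_k := (1−k/m)α + (k/m)β. -/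
open MeasureTheory

open Set Metric
open scoped ENNReal

lemma enorm_deriv_le_lintegral_closedBall {F : Type*} [NormedAddCommGroup F] [NormedSpace ℝ F]
    [CompleteSpace F] {f : ℝ → F} (hf : ContDiff ℝ 2 f) {c ρ x : ℝ} (hρ : 0 < ρ)
    (hx : x ∈ closedBall c ρ) :
    ‖deriv f x‖ₑ ≤ (∫⁻ y in closedBall c ρ, ‖deriv (deriv f) y‖ₑ) +
      ENNReal.ofReal (ρ ^ 2)⁻¹ * ∫⁻ y in closedBall c ρ, ‖f y‖ₑ := by
  have hf1 : ContDiff ℝ 1 (deriv f) := ContDiff.iterate_deriv' 1 1 hf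
  have hd : Differentiable ℝ f := hf.differentiable (by norm_num)
  rw [Real.closedBall_eq_Icc] at *
  have hint : IntegrableOn (fun y => deriv (deriv f) y) (Icc (c - ρ) (c + ρ)) :=
    (hf1.continuous_deriv le_rfl).integrableOn_Icc
  set D : ℝ := ∫ y in Icc (c - ρ) (c + ρ), ‖deriv (deriv f) y‖ with hD
  have hDe : ENNReal.ofReal D = ∫⁻ y in Icc (c - ρ) (c + ρ), ‖deriv (deriv f) y‖ₑ :=
    ofReal_integral_norm_eq_lintegral_enorm hint
  have hvar : ∀ t ∈ Icc (c - ρ) (c + ρ), ‖deriv f t - deriv f x‖ ≤ D := by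
    intro t ht
    have h1 : ∫ y in x..t, deriv (deriv f) y = deriv f t - deriv f x :=
      intervalIntegral.integral_deriv_eq_sub (fun y _ => hf1.differentiable (by norm_num) y)
        ((hf1.continuous_deriv le_rfl).intervalIntegrable _ _)
    rw [← h1]
    refine (intervalIntegral.norm_integral_le_integral_norm_uIoc).trans ?_
    refine setIntegral_mono_set hint.norm (by filter_upwards with y using norm_nonneg _) ?_
    exact (uIoc_subset_uIcc.trans (uIcc_subset_Icc hx ht)).eventuallyLE
  have hpt : ∀ y ∈ Ico (c - ρ) c, ENNReal.ofReal ρ * ‖deriv f x‖ₑ ≤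
      ENNReal.ofReal ρ * ENNReal.ofReal D + (‖f y‖ₑ + ‖f (y + ρ)‖ₑ) := by
    intro y hy
    have hmv : ‖(f (y + ρ) - (y + ρ) • deriv f x) - (f y - y • deriv f x)‖ ≤ D * ‖y + ρ - y‖ := by
      refine Convex.norm_image_sub_le_of_norm_hasDerivWithin_le (s := Icc (c - ρ) (c + ρ))
        (f := fun t => f t - t • deriv f x)
        (f' := fun t => deriv f t - deriv f x) ?_ hvar (convex_Icc _ _) ?_ ?_
      · intro t _
        have := ((hd t).hasDerivAt.sub ((hasDerivAt_id t).smul_const (deriv f x))).hasDerivWithinAt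
          (s := Icc (c - ρ) (c + ρ))
        rw [one_smul] at this
        exact this
      · constructor <;> linarith [hy.1, hy.2]
      · constructor <;> linarith [hy.1, hy.2]
    have hreal : ρ * ‖deriv f x‖ ≤ ρ * D + (‖f y‖ + ‖f (y + ρ)‖) := by
      have e : ρ • deriv f x = f (y + ρ) - f y -
        ((f (y + ρ) - (y + ρ) • deriv f x) - (f y - y • deriv f x)) := by
        rw [add_smul]; abel
      have h2 : ‖ρ • deriv f x‖ ≤ ‖f (y + ρ) - f y‖ + D * ‖y + ρ - y‖ := by
        rw [e]; exact (norm_sub_le _ _).trans (by gcongr)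
      rw [norm_smul, add_sub_cancel_left, Real.norm_of_nonneg hρ.le] at h2
      linarith [norm_sub_le (f (y + ρ)) (f y), mul_comm D ρ]
    simp only [← ofReal_norm]
    rw [← ENNReal.ofReal_mul hρ.le, ← ENNReal.ofReal_mul hρ.le,
      ← ENNReal.ofReal_add (by positivity) (by positivity),
      ← ENNReal.ofReal_add (by positivity) (by positivity)]
    exact ENNReal.ofReal_le_ofReal hreal
  have hcf : Continuous f := hf.continuous
  have hI := setLIntegral_mono' (μ := volume) measurableSet_Ico hpt
  have hvol : volume (Ico (c - ρ) c) = ENNReal.ofReal ρ := by simp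
  have hshift : ∫⁻ y in Ico (c - ρ) c, ‖f (y + ρ)‖ₑ = ∫⁻ y in Ico c (c + ρ), ‖f y‖ₑ := by
    have := (measurePreserving_add_right (volume : Measure ℝ) ρ).setLIntegral_comp_preimage
      (s := Ico c (c + ρ)) (f := fun y => ‖f y‖ₑ) measurableSet_Ico hcf.enorm.measurable
    rw [← this]
    simp
  have hsum : ∫⁻ y in Ico (c - ρ) c, (‖f y‖ₑ + ‖f (y + ρ)‖ₑ) ≤
      ∫⁻ y in Icc (c - ρ) (c + ρ), ‖f y‖ₑ := by
    rw [lintegral_add_left hcf.enorm.measurable, hshift, ← lintegral_union measurableSet_Ico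
      (by rw [Set.disjoint_left]; intro a ha hb; exact absurd hb.1 (not_le.2 ha.2)),
      Ico_union_Ico_eq_Ico (by linarith) (by linarith)]
    exact lintegral_mono_set Ico_subset_Icc_self
  rw [lintegral_add_left (by fun_prop), lintegral_const, lintegral_const,
    Measure.restrict_apply_univ, hvol] at hI
  have hI2 := hI.trans (add_le_add_right hsum _)
  rw [← hDe]
  have hcancel : ENNReal.ofReal (ρ ^ 2)⁻¹ * ENNReal.ofReal (ρ ^ 2) = 1 := by
    rw [← ENNReal.ofReal_mul (by positivity), inv_mul_cancel₀ (by positivity), ENNReal.ofReal_one]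
  have hsq : ENNReal.ofReal (ρ ^ 2) = ENNReal.ofReal ρ * ENNReal.ofReal ρ := by
    rw [← ENNReal.ofReal_mul hρ.le, sq]
  calc ‖deriv f x‖ₑ = ENNReal.ofReal (ρ ^ 2)⁻¹ *
        (ENNReal.ofReal ρ * ‖deriv f x‖ₑ * ENNReal.ofReal ρ) := by
        rw [mul_right_comm, ← hsq, ← mul_assoc, hcancel, one_mul]
    _ ≤ ENNReal.ofReal (ρ ^ 2)⁻¹ * (ENNReal.ofReal ρ * ENNReal.ofReal D * ENNReal.ofReal ρ +
        ∫⁻ y in Icc (c - ρ) (c + ρ), ‖f y‖ₑ) := by gcongr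
    _ = _ := by
        rw [mul_add, mul_right_comm, ← hsq, ← mul_assoc, hcancel, one_mul]

lemma ofReal_setIntegral_norm_rpow {F : Type*} [NormedAddCommGroup F]
    {g : ℝ → F} (hg : Continuous g) (c ρ : ℝ) {p : ℝ} (hp : 0 < p) :
    ENNReal.ofReal (∫ y in closedBall c ρ, ‖g y‖ ^ p) = ∫⁻ y in closedBall c ρ, ‖g y‖ₑ ^ p := by
  rw [ofReal_integral_eq_lintegral_ofReal]
  · refine lintegral_congr fun y => ?_
    rw [← ENNReal.ofReal_rpow_of_nonneg (norm_nonneg _) hp.le, ofReal_norm]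
  · exact (hg.norm.rpow_const fun _ => Or.inr hp.le).continuousOn.integrableOn_compact
      (isCompact_closedBall c ρ)
  · filter_upwards with y using by positivity

lemma lintegral_closedBall_enorm_le {F : Type*} [NormedAddCommGroup F]
    {g : ℝ → F} (hg : Continuous g) (c : ℝ) {ρ : ℝ} (hρ : 0 < ρ) {p : ℝ} (hp : 1 ≤ p) :
    ∫⁻ y in closedBall c ρ, ‖g y‖ₑ ≤ ENNReal.ofReal
      ((2 * ρ) ^ (1 - 1 / p) * (∫ y in closedBall c ρ, ‖g y‖ ^ p) ^ (1 / p)) := by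
  have h := eLpNorm'_le_eLpNorm'_mul_rpow_measure_univ (μ := volume.restrict (closedBall c ρ))
    zero_lt_one hp (hg.aestronglyMeasurable (μ := volume.restrict (closedBall c ρ)))
  simp only [eLpNorm'_eq_lintegral_enorm, ENNReal.rpow_one, div_one, Measure.restrict_apply_univ,
    Real.volume_closedBall] at h
  rw [← ofReal_setIntegral_norm_rpow hg c ρ (by positivity),
    ENNReal.ofReal_rpow_of_nonneg (by positivity) (by positivity),
    ENNReal.ofReal_rpow_of_pos (by positivity), ← ENNReal.ofReal_mul (by positivity)] at h
  rwa [mul_comm] at h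

lemma norm_deriv_le_rpow_setIntegral {F : Type*} [NormedAddCommGroup F] [NormedSpace ℝ F]
    [CompleteSpace F] {f : ℝ → F} (hf : ContDiff ℝ 2 f) {c ρ x : ℝ} (hρ : 0 < ρ)
    (hx : x ∈ closedBall c ρ) {p q : ℝ} (hp : 1 ≤ p) (hq : 1 ≤ q) :
    ‖deriv f x‖ ≤ (2 * ρ) ^ (1 - 1 / q) *
        (∫ y in closedBall c ρ, ‖deriv (deriv f) y‖ ^ q) ^ (1 / q) +
      4 * ((2 * ρ) ^ (-1 - 1 / p) * (∫ y in closedBall c ρ, ‖f y‖ ^ p) ^ (1 / p)) := by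
  have hf1 : ContDiff ℝ 1 (deriv f) := ContDiff.iterate_deriv' 1 1 hf
  have h := enorm_deriv_le_lintegral_closedBall hf hρ hx
  have h1 := lintegral_closedBall_enorm_le (hf1.continuous_deriv le_rfl) c hρ hq
  have h2 := lintegral_closedBall_enorm_le hf.continuous c hρ hp
  have h3 := h.trans (add_le_add h1 (mul_le_mul_right h2 _))
  rw [← ENNReal.ofReal_mul (by positivity), ← ENNReal.ofReal_add (by positivity) (by positivity),
    ← ofReal_norm, ENNReal.ofReal_le_ofReal_iff (by positivity)] at h3
  refine h3.trans (le_of_eq ?_)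
  have e : (2 * ρ) ^ (1 - 1 / p) = (2 * ρ) ^ 2 * (2 * ρ) ^ (-1 - 1 / p) := by
    rw [← Real.rpow_natCast, ← Real.rpow_add (by positivity)]
    norm_num; ring_nf
  rw [e]
  field_simp
  ring

lemma continuousOn_setIntegral_closedBall {g : ℝ → ℝ} (hg : Continuous g) (c : ℝ) :
    ContinuousOn (fun ρ => ∫ y in closedBall c ρ, g y) (Ici 0) := by
  have h : Continuous fun ρ : ℝ => ∫ y in (c - ρ)..(c + ρ), g y :=
    by
      have := intervalIntegral.continuous_parametric_intervalIntegral_of_continuous (μ := volume)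
        (f := fun (_ : ℝ) y => g y) (a₀ := 0) (by fun_prop) (s := fun ρ => c + ρ) (by fun_prop)
      have h' := intervalIntegral.continuous_parametric_intervalIntegral_of_continuous (μ := volume)
        (f := fun (_ : ℝ) y => g y) (a₀ := 0) (by fun_prop) (s := fun ρ => c - ρ) (by fun_prop)
      refine (this.sub h').congr fun ρ => ?_
      exact intervalIntegral.integral_interval_sub_left (hg.intervalIntegrable _ _)
        (hg.intervalIntegrable _ _)
  refine h.continuousOn.congr fun ρ hρ => ?_
  rw [mem_Ici] at hρ
  simp only
  rw [intervalIntegral.integral_of_le (by linarith), Real.closedBall_eq_Icc,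
    integral_Icc_eq_integral_Ioc]

/-- Every point where `f'` does not vanish is the center of a ball, of radius bounded in terms of
`f`, on which the two terms of `norm_deriv_le_rpow_setIntegral` are balanced. -/
lemma exists_balanced_radius {F : Type*} [NormedAddCommGroup F] [NormedSpace ℝ F]
    [CompleteSpace F] {f : ℝ → F} (hf : ContDiff ℝ 2 f) (hs : HasCompactSupport f)
    {p q : ℝ} (hp : 1 ≤ p) (hq : 1 ≤ q) :
    ∃ R : ℝ, ∀ c, deriv f c ≠ 0 → ∃ ρ, 0 < ρ ∧ ρ ≤ R ∧
      (2 * ρ) ^ (1 - 1 / q) * (∫ y in closedBall c ρ, ‖deriv (deriv f) y‖ ^ q) ^ (1 / q) =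
      (2 * ρ) ^ (-1 - 1 / p) * (∫ y in closedBall c ρ, ‖f y‖ ^ p) ^ (1 / p) := by
  have hp0 : 0 < p := by linarith
  have hq0 : 0 < q := by linarith
  have hp1 : 0 ≤ 1 / p := by positivity
  have hq1 : 1 / q ≤ 1 := by rw [div_le_one hq0]; exact hq
  have hf1 : ContDiff ℝ 1 (deriv f) := ContDiff.iterate_deriv' 1 1 hf
  have hc2 : Continuous (deriv (deriv f)) := hf1.continuous_deriv le_rfl
  have hgA : Continuous fun y => ‖f y‖ ^ p :=
    hf.continuous.norm.rpow_const fun _ => Or.inr hp0.le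
  have hgB : Continuous fun y => ‖deriv (deriv f) y‖ ^ q :=
    hc2.norm.rpow_const fun _ => Or.inr hq0.le
  obtain ⟨R₀, hR₀⟩ := hs.isCompact.isBounded.subset_closedBall (0 : ℝ)
  obtain ⟨M, hM⟩ := hs.deriv.deriv.exists_bound_of_continuous hc2
  set A : ℝ := ∫ y, ‖f y‖ ^ p
  set B : ℝ := ∫ y, ‖deriv (deriv f) y‖ ^ q
  have hB0 : 0 ≤ B := integral_nonneg fun y => by positivity
  have hA0 : 0 ≤ A := integral_nonneg fun y => by positivity
  refine ⟨max (2 * R₀) (max 1 (A ^ (1 / p) / B ^ (1 / q))), fun c hc => ?_⟩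
  set R := max (2 * R₀) (max 1 (A ^ (1 / p) / B ^ (1 / q)))
  have hR1 : 1 ≤ R := (le_max_left _ _).trans (le_max_right _ _)
  have hRpos : 0 < R := by linarith
  have hsub : tsupport f ⊆ closedBall c R := by
    intro y hy
    have h1 := hR₀ hy
    have h2 := hR₀ (tsupport_deriv_subset (subset_tsupport _ (Function.mem_support.2 hc)))
    have h3 : 2 * R₀ ≤ R := le_max_left _ _
    rw [mem_closedBall] at *
    linarith [dist_triangle_right y c 0]
  have hBpos : 0 < B := by
    obtain ⟨x, hnz⟩ : ∃ x, ‖deriv (deriv f) x‖ ^ q ≠ 0 := by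
      by_contra! h0
      have h1 : ∀ y, deriv (deriv f) y = 0 := fun y => by
        have := h0 y
        simpa [Real.rpow_eq_zero_iff_of_nonneg, hq0.ne'] using this
      have h2 := is_const_of_deriv_eq_zero (hf1.differentiable (by norm_num)) h1 c (|R₀| + 1)
      refine hc (h2.trans (image_eq_zero_of_notMem_tsupport fun h => ?_))
      have h3 := hR₀ (tsupport_deriv_subset h)
      rw [mem_closedBall_zero_iff, Real.norm_eq_abs] at h3
      linarith [le_abs_self (|R₀| + 1), le_abs_self R₀]
    refine Continuous.integral_pos_of_hasCompactSupport_nonneg_nonzero hgB ?_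
      (fun y => by positivity) hnz
    exact hs.deriv.deriv.comp_left (g := fun z => ‖z‖ ^ q) (by simp [hq0.ne'])
  have hAR : ∫ y in closedBall c R, ‖f y‖ ^ p = A := by
    refine setIntegral_eq_integral_of_forall_compl_eq_zero fun y hy => ?_
    rw [image_eq_zero_of_notMem_tsupport fun h => hy (hsub h), norm_zero,
      Real.zero_rpow hp0.ne']
  have hBR : ∫ y in closedBall c R, ‖deriv (deriv f) y‖ ^ q = B := by
    refine setIntegral_eq_integral_of_forall_compl_eq_zero fun y hy => ?_
    rw [image_eq_zero_of_notMem_tsupport fun h =>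
      hy (hsub (tsupport_deriv_subset (tsupport_deriv_subset h))), norm_zero,
      Real.zero_rpow hq0.ne']
  have hlarge : (2 * R) ^ (-1 - 1 / p) * (∫ y in closedBall c R, ‖f y‖ ^ p) ^ (1 / p) ≤
      (2 * R) ^ (1 - 1 / q) * (∫ y in closedBall c R, ‖deriv (deriv f) y‖ ^ q) ^ (1 / q) := by
    rw [hAR, hBR]
    have hBp : 0 < B ^ (1 / q) := by positivity
    have h1 : A ^ (1 / p) ≤ R * B ^ (1 / q) := by
      rw [← div_le_iff₀ hBp]
      exact (le_max_right _ _).trans (le_max_right _ _)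
    have h2 : (2 * R) ^ (-1 - 1 / p) ≤ (2 * R) ^ (-1 : ℝ) :=
      Real.rpow_le_rpow_of_exponent_le (by linarith) (by linarith)
    have h3 : (1 : ℝ) ≤ (2 * R) ^ (1 - 1 / q) :=
      Real.one_le_rpow (by linarith) (by linarith)
    rw [Real.rpow_neg_one] at h2
    calc _ ≤ (2 * R)⁻¹ * (R * B ^ (1 / q)) := by gcongr
      _ = 2⁻¹ * B ^ (1 / q) := by field_simp
      _ ≤ 1 * B ^ (1 / q) := by gcongr; norm_num
      _ ≤ _ := by gcongr
  have hM0 : 0 ≤ M := (norm_nonneg _).trans (hM 0)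
  have hfc : 0 < ‖deriv f c‖ := norm_pos_iff.2 hc
  obtain ⟨ρ₀, hρ₀, hρ₀R, hρ₀M⟩ : ∃ ρ₀, 0 < ρ₀ ∧ ρ₀ ≤ R ∧ 10 * M * ρ₀ < ‖deriv f c‖ := by
    refine ⟨min R (‖deriv f c‖ / (10 * M + 1)), by positivity, min_le_left _ _, ?_⟩
    have h1 : min R (‖deriv f c‖ / (10 * M + 1)) * (10 * M + 1) ≤ ‖deriv f c‖ := by
      rw [← le_div_iff₀ (by positivity)]; exact min_le_right _ _
    have h2 : 0 < min R (‖deriv f c‖ / (10 * M + 1)) := by positivity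
    linarith
  have hsmall : (2 * ρ₀) ^ (1 - 1 / q) *
      (∫ y in closedBall c ρ₀, ‖deriv (deriv f) y‖ ^ q) ^ (1 / q) ≤
      (2 * ρ₀) ^ (-1 - 1 / p) * (∫ y in closedBall c ρ₀, ‖f y‖ ^ p) ^ (1 / p) := by
    by_contra! hlt
    have h1 := norm_deriv_le_rpow_setIntegral hf hρ₀ (mem_closedBall_self hρ₀.le) hp hq (x := c)
    have h2 : ∫ y in closedBall c ρ₀, ‖deriv (deriv f) y‖ ^ q ≤ M ^ q * (2 * ρ₀) := by
      have := setIntegral_mono_on (μ := volume) (s := closedBall c ρ₀)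
        (hgB.continuousOn.integrableOn_compact (isCompact_closedBall c ρ₀))
        (g := fun _ => M ^ q) (by simp [ENNReal.mul_lt_top]) measurableSet_closedBall
        (fun y _ => Real.rpow_le_rpow (norm_nonneg _) (hM y) hq0.le)
      simpa [Real.volume_real_closedBall hρ₀.le, mul_comm] using this
    have h3 : (∫ y in closedBall c ρ₀, ‖deriv (deriv f) y‖ ^ q) ^ (1 / q) ≤
        M * (2 * ρ₀) ^ (1 / q) := by
      refine (Real.rpow_le_rpow (by positivity) h2 (by positivity)).trans (le_of_eq ?_)
      rw [Real.mul_rpow (by positivity) (by positivity), ← Real.rpow_mul hM0,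
        mul_one_div_cancel hq0.ne', Real.rpow_one]
    have h4 : (2 * ρ₀) ^ (1 - 1 / q) *
        (∫ y in closedBall c ρ₀, ‖deriv (deriv f) y‖ ^ q) ^ (1 / q) ≤ M * (2 * ρ₀) := by
      calc _ ≤ (2 * ρ₀) ^ (1 - 1 / q) * (M * (2 * ρ₀) ^ (1 / q)) := by gcongr
        _ = M * ((2 * ρ₀) ^ (1 - 1 / q) * (2 * ρ₀) ^ (1 / q)) := by ring
        _ = _ := by rw [← Real.rpow_add (by positivity), sub_add_cancel, Real.rpow_one]
    linarith
  have hsubI : Icc ρ₀ R ⊆ Ici 0 := fun y hy => hρ₀.le.trans hy.1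
  have hpow : ∀ s : ℝ, ContinuousOn (fun ρ : ℝ => (2 * ρ) ^ s) (Icc ρ₀ R) := fun s =>
    ContinuousOn.rpow_const (by fun_prop) fun y hy => Or.inl (by linarith [hy.1])
  obtain ⟨ρ, hρ, h⟩ := isPreconnected_Icc.intermediate_value₂ (left_mem_Icc.2 hρ₀R)
    (right_mem_Icc.2 hρ₀R)
    ((hpow (1 - 1 / q)).mul (((continuousOn_setIntegral_closedBall hgB c).mono hsubI).rpow_const
      fun _ _ => Or.inr (by positivity : 0 ≤ 1 / q)))
    ((hpow (-1 - 1 / p)).mul (((continuousOn_setIntegral_closedBall hgA c).mono hsubI).rpow_const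
      fun _ _ => Or.inr hp1))
    hsmall hlarge
  exact ⟨ρ, hρ₀.trans_le hρ.1, hρ.2, h⟩

lemma setLIntegral_enorm_deriv_le_of_balanced {F : Type*} [NormedAddCommGroup F] [NormedSpace ℝ F]
    [CompleteSpace F] {f : ℝ → F} (hf : ContDiff ℝ 2 f) {c ρ : ℝ} (hρ : 0 < ρ)
    {p q r : ℝ} (hp : 1 ≤ p) (hq : 1 ≤ q) (hr : 0 < r) (hpqr : r / (2 * p) + r / (2 * q) = 1)
    (h : (2 * ρ) ^ (1 - 1 / q) * (∫ y in closedBall c ρ, ‖deriv (deriv f) y‖ ^ q) ^ (1 / q) =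
      (2 * ρ) ^ (-1 - 1 / p) * (∫ y in closedBall c ρ, ‖f y‖ ^ p) ^ (1 / p)) :
    ∫⁻ y in closedBall c ρ, ‖deriv f y‖ₑ ^ r ≤ 5 ^ r *
      ((∫⁻ y in closedBall c ρ, ‖f y‖ₑ ^ p) ^ (r / (2 * p)) *
      (∫⁻ y in closedBall c ρ, ‖deriv (deriv f) y‖ₑ ^ q) ^ (r / (2 * q))) := by
  have hp0 : 0 < p := by linarith
  have hq0 : 0 < q := by linarith
  have hf1 : ContDiff ℝ 1 (deriv f) := ContDiff.iterate_deriv' 1 1 hf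
  have hc2 : Continuous (deriv (deriv f)) := hf1.continuous_deriv le_rfl
  rw [← ofReal_setIntegral_norm_rpow hf.continuous c ρ hp0,
    ← ofReal_setIntegral_norm_rpow hc2 c ρ hq0,
    ← ofReal_setIntegral_norm_rpow hf1.continuous c ρ hr]
  set a := ∫ y in closedBall c ρ, ‖f y‖ ^ p
  set b := ∫ y in closedBall c ρ, ‖deriv (deriv f) y‖ ^ q
  have ha : 0 ≤ a := integral_nonneg fun y => by positivity
  have hb : 0 ≤ b := integral_nonneg fun y => by positivity
  set T := (2 * ρ) ^ (1 - 1 / q) * b ^ (1 / q) with hT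
  have hT0 : 0 ≤ T := by positivity
  have hTr : T ^ r * (2 * ρ) = a ^ (r / (2 * p)) * b ^ (r / (2 * q)) := by
    have h1 : T ^ r = (T ^ (r / 2)) * (T ^ (r / 2)) := by
      rw [← Real.rpow_add_of_nonneg hT0 (by positivity) (by positivity), add_halves]
    have h2 : T ^ (r / 2) = (2 * ρ) ^ ((1 - 1 / q) * (r / 2)) * b ^ (r / (2 * q)) := by
      rw [hT, Real.mul_rpow (by positivity) (by positivity), ← Real.rpow_mul (by positivity),
        ← Real.rpow_mul hb]
      congr 2; field_simp
    have h3 : T ^ (r / 2) = (2 * ρ) ^ ((-1 - 1 / p) * (r / 2)) * a ^ (r / (2 * p)) := by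
      rw [h, Real.mul_rpow (by positivity) (by positivity), ← Real.rpow_mul (by positivity),
        ← Real.rpow_mul ha]
      congr 2; field_simp
    have h4 : (2 * ρ) ^ ((1 - 1 / q) * (r / 2)) * (2 * ρ) ^ ((-1 - 1 / p) * (r / 2)) *
        (2 * ρ) = 1 := by
      rw [← Real.rpow_add (by positivity), ← Real.rpow_add_one (by positivity)]
      rw [show (1 - 1 / q) * (r / 2) + (-1 - 1 / p) * (r / 2) + 1 =
        1 - (r / (2 * p) + r / (2 * q)) by field_simp; ring, hpqr, sub_self, Real.rpow_zero]
    rw [h1]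
    nth_rewrite 1 [h2]
    rw [h3]
    linear_combination (a ^ (r / (2 * p)) * b ^ (r / (2 * q))) * h4
  have hle : ∫ y in closedBall c ρ, ‖deriv f y‖ ^ r ≤
      5 ^ r * (a ^ (r / (2 * p)) * b ^ (r / (2 * q))) := by
    have hpt : ∀ y ∈ closedBall c ρ, ‖deriv f y‖ ^ r ≤ (5 * T) ^ r := fun y hy => by
      refine Real.rpow_le_rpow (norm_nonneg _) ?_ hr.le
      have := norm_deriv_le_rpow_setIntegral hf hρ hy hp hq
      rw [← h, ← hT] at this
      linarith
    have := setIntegral_mono_on (μ := volume) (s := closedBall c ρ)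
      ((hf1.continuous.norm.rpow_const fun _ => Or.inr hr.le).continuousOn.integrableOn_compact
        (isCompact_closedBall c ρ))
      (g := fun _ => (5 * T) ^ r) (by simp [ENNReal.mul_lt_top]) measurableSet_closedBall hpt
    rw [← hTr, ← mul_assoc, ← Real.mul_rpow (by norm_num) hT0]
    simpa [Real.volume_real_closedBall hρ.le, mul_comm] using this
  refine (ENNReal.ofReal_le_ofReal hle).trans (le_of_eq ?_)
  rw [ENNReal.ofReal_mul (by positivity), ENNReal.ofReal_mul (by positivity),
    ENNReal.ofReal_rpow_of_nonneg ha (by positivity),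
    ENNReal.ofReal_rpow_of_nonneg hb (by positivity), ← ENNReal.ofReal_rpow_of_pos (by norm_num)]
  norm_num

lemma tsum_rpow_mul_rpow_le {ι : Type*} (a b : ι → ℝ≥0∞) {s t : ℝ} (hs : 0 ≤ s) (ht : 0 ≤ t)
    (hst : s + t = 1) : ∑' i, a i ^ s * b i ^ t ≤ (∑' i, a i) ^ s * (∑' i, b i) ^ t := by
  let _ : MeasurableSpace ι := ⊤
  have h := ENNReal.lintegral_mul_norm_pow_le (μ := Measure.count) (f := a) (g := b)
    (measurable_from_top).aemeasurable (measurable_from_top).aemeasurable hs ht hst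
  simpa only [lintegral_count] using h

/-- The one-dimensional interpolation inequality between `f`, `f'` and `f''`. -/
lemma lintegral_enorm_deriv_rpow_le {N : ℕ} {τ : ℝ} (hτ : 1 < τ)
    (hN : IsEmpty (Besicovitch.SatelliteConfig ℝ N τ))
    {F : Type*} [NormedAddCommGroup F] [NormedSpace ℝ F]
    [CompleteSpace F] {f : ℝ → F} (hf : ContDiff ℝ 2 f) (hs : HasCompactSupport f)
    {p q r : ℝ} (hp : 1 ≤ p) (hq : 1 ≤ q) (hr : 0 < r) (hpqr : r / (2 * p) + r / (2 * q) = 1) :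
    ∫⁻ y, ‖deriv f y‖ₑ ^ r ≤ N * 5 ^ r *
      ((∫⁻ y, ‖f y‖ₑ ^ p) ^ (r / (2 * p)) *
      (∫⁻ y, ‖deriv (deriv f) y‖ₑ ^ q) ^ (r / (2 * q))) := by
  have hp0 : 0 < p := by linarith
  have hq0 : 0 < q := by linarith
  obtain ⟨R, hR⟩ := exists_balanced_radius hf hs hp hq
  choose! ρ hρ hρR hbal using hR
  obtain ⟨s, hdisj, hcov⟩ := Besicovitch.exist_disjoint_covering_families hτ hN
    (⟨fun c => c, fun c => ρ c, fun c => hρ c c.2, R, fun c => hρR c c.2⟩ :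
      Besicovitch.BallPackage {c // deriv f c ≠ 0} ℝ)
  simp only [Subtype.range_coe_subtype] at hdisj hcov
  set S : ℝ≥0∞ := (∫⁻ y, ‖f y‖ₑ ^ p) ^ (r / (2 * p)) *
      (∫⁻ y, ‖deriv (deriv f) y‖ₑ ^ q) ^ (r / (2 * q))
  have hfam : ∀ i, ∫⁻ y in ⋃ j : s i, closedBall (j : ℝ) (ρ j), ‖deriv f y‖ₑ ^ r ≤ 5 ^ r * S := by
    intro i
    have hd : Pairwise (Function.onFun Disjoint fun j : s i => closedBall ((j : _) : ℝ) (ρ j)) :=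
      (hdisj i).subtype _ _
    have hcount : Countable (s i) := by
      refine ((hdisj i).countable_of_nonempty_interior fun j _ => ?_).to_subtype
      exact ⟨j, ball_subset_interior_closedBall (mem_ball_self (hρ j j.2))⟩
    have hsum : ∀ g : ℝ → ℝ≥0∞, ∑' j : s i, ∫⁻ y in closedBall (j : ℝ) (ρ j), g y ≤ ∫⁻ y, g y := by
      intro g
      rw [← lintegral_iUnion (fun j => measurableSet_closedBall) hd]
      exact setLIntegral_le_lintegral _ _
    calc ∫⁻ y in ⋃ j : s i, closedBall (j : ℝ) (ρ j), ‖deriv f y‖ₑ ^ r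
        ≤ ∑' j : s i, ∫⁻ y in closedBall (j : ℝ) (ρ j), ‖deriv f y‖ₑ ^ r := lintegral_iUnion_le _ _
      _ ≤ ∑' j : s i, 5 ^ r *
          ((∫⁻ y in closedBall (j : ℝ) (ρ j), ‖f y‖ₑ ^ p) ^ (r / (2 * p)) *
          (∫⁻ y in closedBall (j : ℝ) (ρ j), ‖deriv (deriv f) y‖ₑ ^ q) ^ (r / (2 * q))) :=
        ENNReal.tsum_le_tsum fun j => setLIntegral_enorm_deriv_le_of_balanced hf
          (hρ j j.1.2) hp hq hr hpqr (hbal j j.1.2)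
      _ ≤ 5 ^ r * S := by
        rw [ENNReal.tsum_mul_left]
        gcongr
        refine (tsum_rpow_mul_rpow_le _ _ (by positivity) (by positivity) hpqr).trans ?_
        exact mul_le_mul' (ENNReal.rpow_le_rpow (hsum _) (by positivity))
          (ENNReal.rpow_le_rpow (hsum _) (by positivity))
  have hsupp : Function.support (fun y => ‖deriv f y‖ₑ ^ r) ⊆
      ⋃ i, ⋃ j : s i, closedBall (j : ℝ) (ρ j) := by
    intro y hy
    have hy' : deriv f y ≠ 0 := fun h => hy (by simp [h, hr])
    obtain ⟨i, hi⟩ := mem_iUnion.1 (hcov hy')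
    obtain ⟨j, hj⟩ := mem_iUnion.1 hi
    obtain ⟨hj, hyj⟩ := mem_iUnion.1 hj
    exact mem_iUnion.2 ⟨i, mem_iUnion.2 ⟨⟨j, hj⟩, ball_subset_closedBall hyj⟩⟩
  calc ∫⁻ y, ‖deriv f y‖ₑ ^ r
      ≤ ∫⁻ y in ⋃ i, ⋃ j : s i, closedBall (j : ℝ) (ρ j), ‖deriv f y‖ₑ ^ r := by
        rw [setLIntegral_eq_of_support_subset hsupp]
    _ ≤ ∑' i, ∫⁻ y in ⋃ j : s i, closedBall (j : ℝ) (ρ j), ‖deriv f y‖ₑ ^ r :=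
        lintegral_iUnion_le _ _
    _ ≤ ∑' i : Fin N, 5 ^ r * S := ENNReal.tsum_le_tsum hfam
    _ = N * 5 ^ r * S := by simp [tsum_fintype, mul_assoc]

lemma lintegral_eq_lintegral_insertNth {n : ℕ} (i : Fin (n + 1))
    {g : EuclideanSpace ℝ (Fin (n + 1)) → ℝ≥0∞} (hg : Measurable g) :
    ∫⁻ x, g x = ∫⁻ y : Fin n → ℝ, ∫⁻ t : ℝ, g (WithLp.toLp 2 (i.insertNth t y)) := by
  rw [← (PiLp.volume_preserving_toLp (Fin (n + 1))).lintegral_comp hg,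
    ← ((volume_preserving_piFinSuccAbove (fun _ : Fin (n + 1) => ℝ) i).symm).lintegral_comp
      (f := fun z => g (WithLp.toLp 2 z)) (hg.comp (WithLp.measurable_toLp 2 _)),
    Measure.volume_eq_prod,
    lintegral_prod_symm]
  · rfl
  · exact (hg.comp ((WithLp.measurable_toLp 2 _).comp (MeasurableEquiv.measurable _))).aemeasurable

lemma toLp_insertNth_eq_add_smul {n : ℕ} (i : Fin (n + 1)) (t : ℝ) (y : Fin n → ℝ) :
    WithLp.toLp 2 (i.insertNth t y : Fin (n + 1) → ℝ) =
      WithLp.toLp 2 (i.insertNth 0 y : Fin (n + 1) → ℝ) + t • EuclideanSpace.single i (1 : ℝ) := by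
  ext j
  refine Fin.succAboveCases i ?_ (fun k => ?_) j
  · simp
  · simp [Fin.succAbove_ne]

lemma hasCompactSupport_comp_line {E F : Type*} [NormedAddCommGroup E] [NormedSpace ℝ E]
    [Zero F] {v : E → F} (hs : HasCompactSupport v) (x : E) {e : E} (he : ‖e‖ = 1) :
    HasCompactSupport fun t : ℝ => v (x + t • e) := by
  have hiso : Isometry fun t : ℝ => x + t • e := Isometry.of_dist_eq fun s t => by
    rw [dist_add_left, dist_eq_norm, ← sub_smul, norm_smul, he, mul_one, dist_eq_norm]
  exact hs.comp_isClosedEmbedding hiso.isClosedEmbedding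

lemma deriv_comp_line {E F : Type*} [NormedAddCommGroup E] [NormedSpace ℝ E]
    [NormedAddCommGroup F] [NormedSpace ℝ F] {v : E → F} (hv : Differentiable ℝ v) (x e : E) :
    deriv (fun t : ℝ => v (x + t • e)) = fun t => fderiv ℝ v (x + t • e) e := by
  funext t
  have h : HasDerivAt (fun t : ℝ => x + t • e) e t := by
    simpa using ((hasDerivAt_id t).smul_const e).const_add x
  exact ((hv _).hasFDerivAt.comp_hasDerivAt t h).deriv

lemma lintegral_enorm_fderiv_apply_single_le {N : ℕ} {τ : ℝ} (hτ : 1 < τ)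
    (hN : IsEmpty (Besicovitch.SatelliteConfig ℝ N τ)) {n : ℕ} (i : Fin (n + 1))
    {F : Type*} [NormedAddCommGroup F] [NormedSpace ℝ F] [CompleteSpace F]
    {v : EuclideanSpace ℝ (Fin (n + 1)) → F} (hv : ContDiff ℝ 2 v) (hs : HasCompactSupport v)
    {p q r : ℝ} (hp : 1 ≤ p) (hq : 1 ≤ q) (hr : 0 < r) (hpqr : r / (2 * p) + r / (2 * q) = 1) :
    ∫⁻ x, ‖fderiv ℝ v x (EuclideanSpace.single i 1)‖ₑ ^ r ≤ N * 5 ^ r *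
      ((∫⁻ x, ‖v x‖ₑ ^ p) ^ (r / (2 * p)) *
      (∫⁻ x, ‖fderiv ℝ (fderiv ℝ v) x‖ₑ ^ q) ^ (r / (2 * q))) := by
  have hp0 : 0 < p := by linarith
  have hq0 : 0 < q := by linarith
  set e : EuclideanSpace ℝ (Fin (n + 1)) := EuclideanSpace.single i 1 with he_def
  have he : ‖e‖ = 1 := by simp [he_def]
  have hv1 : ContDiff ℝ 1 (fderiv ℝ v) := hv.fderiv_right le_rfl
  have hve : ContDiff ℝ 1 fun x => fderiv ℝ v x e := hv1.clm_apply contDiff_const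
  have hm0 : Measurable fun x => ‖v x‖ₑ ^ p := hv.continuous.enorm.measurable.pow_const _
  have hm1 : Measurable fun x => ‖fderiv ℝ v x e‖ₑ ^ r :=
    hve.continuous.enorm.measurable.pow_const _
  have hm2 : Measurable fun x => ‖fderiv ℝ (fderiv ℝ v) x‖ₑ ^ q :=
    (hv1.continuous_fderiv one_ne_zero).enorm.measurable.pow_const _
  have hline : ∀ y : Fin n → ℝ,
      ∫⁻ t : ℝ, ‖fderiv ℝ v (WithLp.toLp 2 (i.insertNth t y)) e‖ₑ ^ r ≤ N * 5 ^ r *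
      ((∫⁻ t : ℝ, ‖v (WithLp.toLp 2 (i.insertNth t y))‖ₑ ^ p) ^ (r / (2 * p)) *
      (∫⁻ t : ℝ, ‖fderiv ℝ (fderiv ℝ v) (WithLp.toLp 2 (i.insertNth t y))‖ₑ ^ q) ^
        (r / (2 * q))) := by
    intro y
    obtain ⟨x₀, hx₀⟩ : ∃ x₀ : EuclideanSpace ℝ (Fin (n + 1)), ∀ t : ℝ,
        WithLp.toLp 2 (i.insertNth t y : Fin (n + 1) → ℝ) = x₀ + t • e :=
      ⟨_, fun t => toLp_insertNth_eq_add_smul i t y⟩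
    simp only [hx₀]
    have h := lintegral_enorm_deriv_rpow_le hτ hN (f := fun t : ℝ => v (x₀ + t • e))
      (hv.comp (by fun_prop)) (hasCompactSupport_comp_line hs x₀ he) hp hq hr hpqr
    rw [deriv_comp_line (hv.differentiable (by norm_num)),
      deriv_comp_line (v := fun x => fderiv ℝ v x e) (hve.differentiable (by norm_num))] at h
    refine h.trans ?_
    gcongr with t
    have hfd : fderiv ℝ (fun x => fderiv ℝ v x e) (x₀ + t • e) e =
        fderiv ℝ (fderiv ℝ v) (x₀ + t • e) e e := by
      rw [fderiv_clm_apply (hv1.differentiable (by norm_num) _) (differentiableAt_const e)]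
      simp
    beta_reduce
    rw [hfd]
    rw [← ofReal_norm, ← ofReal_norm]
    refine ENNReal.ofReal_le_ofReal ?_
    refine (ContinuousLinearMap.le_opNorm₂ _ _ _).trans ?_
    rw [he, mul_one, mul_one]
  rw [lintegral_eq_lintegral_insertNth i hm0, lintegral_eq_lintegral_insertNth i hm1,
    lintegral_eq_lintegral_insertNth i hm2]
  refine (lintegral_mono hline).trans ?_
  have hmeas : ∀ g : EuclideanSpace ℝ (Fin (n + 1)) → ℝ≥0∞, Measurable g →
      Measurable fun y : Fin n → ℝ => ∫⁻ t : ℝ, g (WithLp.toLp 2 (i.insertNth t y)) := by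
    intro g hg
    exact Measurable.lintegral_prod_left' (f := fun z : ℝ × (Fin n → ℝ) =>
      g (WithLp.toLp 2 ((MeasurableEquiv.piFinSuccAbove (fun _ => ℝ) i).symm z)))
      (hg.comp ((WithLp.measurable_toLp 2 _).comp (MeasurableEquiv.measurable _)))
  rw [lintegral_const_mul _ (by
    exact ((hmeas _ hm0).pow_const _).mul ((hmeas _ hm2).pow_const _))]
  gcongr
  exact ENNReal.lintegral_mul_norm_pow_le (hmeas _ hm0).aemeasurable (hmeas _ hm2).aemeasurable
    (by positivity) (by positivity) hpqr

lemma eLpNorm_ofReal_eq_lintegral {α F : Type*} [MeasurableSpace α] {μ : Measure α}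
    [ENorm F] (v : α → F) {p : ℝ} (hp : 0 < p) :
    eLpNorm v (ENNReal.ofReal p) μ = (∫⁻ x, ‖v x‖ₑ ^ p ∂μ) ^ (1 / p) := by
  rw [eLpNorm_eq_lintegral_rpow_enorm_toReal (by simpa using hp) (by simp),
    ENNReal.toReal_ofReal hp.le]

lemma norm_clm_le_sum_single {n : ℕ} {F : Type*} [NormedAddCommGroup F] [NormedSpace ℝ F]
    (L : EuclideanSpace ℝ (Fin n) →L[ℝ] F) : ‖L‖ ≤ ∑ i, ‖L (EuclideanSpace.single i 1)‖ := by
  refine L.opNorm_le_bound (by positivity) fun x => ?_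
  have hx : x = ∑ i, x i • EuclideanSpace.single i (1 : ℝ) := by
    simpa using ((EuclideanSpace.basisFun (Fin n) ℝ).sum_repr x).symm
  conv_lhs => rw [hx]
  rw [map_sum, Finset.sum_mul]
  refine (norm_sum_le _ _).trans (Finset.sum_le_sum fun i _ => ?_)
  rw [map_smul, norm_smul, mul_comm]
  gcongr
  exact PiLp.norm_apply_le x i

/-- The interpolation inequality between `v`, `∇v` and `∇²v`. -/
lemma eLpNorm_fderiv_le_interpolate {N : ℕ} {τ : ℝ} (hτ : 1 < τ)
    (hN : IsEmpty (Besicovitch.SatelliteConfig ℝ N τ)) {n : ℕ}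
    {F : Type*} [NormedAddCommGroup F] [NormedSpace ℝ F] [CompleteSpace F]
    {v : EuclideanSpace ℝ (Fin (n + 1)) → F} (hv : ContDiff ℝ 2 v) (hs : HasCompactSupport v)
    {p q r : ℝ} (hp : 1 ≤ p) (hq : 1 ≤ q) (hr : 1 ≤ r) (hpqr : r / (2 * p) + r / (2 * q) = 1) :
    eLpNorm (fderiv ℝ v) (ENNReal.ofReal r) volume ≤ ((n + 1) * ((N + 1) * 5) : ℕ) *
      (eLpNorm v (ENNReal.ofReal p) volume ^ (1 / 2 : ℝ) *
      eLpNorm (fderiv ℝ (fderiv ℝ v)) (ENNReal.ofReal q) volume ^ (1 / 2 : ℝ)) := by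
  have hp0 : 0 < p := by linarith
  have hq0 : 0 < q := by linarith
  have hr0 : 0 < r := by linarith
  have hcont : ∀ e, Continuous fun x => fderiv ℝ v x e := fun e =>
    (hv.continuous_fderiv (by norm_num)).clm_apply continuous_const
  set S := eLpNorm v (ENNReal.ofReal p) volume ^ (1 / 2 : ℝ) *
      eLpNorm (fderiv ℝ (fderiv ℝ v)) (ENNReal.ofReal q) volume ^ (1 / 2 : ℝ) with hS
  have hdir : ∀ i : Fin (n + 1), eLpNorm (fun x => fderiv ℝ v x (EuclideanSpace.single i 1))
      (ENNReal.ofReal r) volume ≤ ((N + 1) * 5 : ℕ) * S := by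
    intro i
    rw [hS, eLpNorm_ofReal_eq_lintegral _ hp0, eLpNorm_ofReal_eq_lintegral _ hq0,
      eLpNorm_ofReal_eq_lintegral _ hr0]
    refine (ENNReal.rpow_le_rpow
      (lintegral_enorm_fderiv_apply_single_le hτ hN i hv hs hp hq hr0 hpqr)
      (by positivity : 0 ≤ 1 / r)).trans ?_
    have hi : 0 ≤ 1 / r := by positivity
    rw [ENNReal.mul_rpow_of_nonneg _ _ hi, ENNReal.mul_rpow_of_nonneg _ _ hi,
      ENNReal.mul_rpow_of_nonneg _ _ hi, ← ENNReal.rpow_mul, ← ENNReal.rpow_mul,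
      ← ENNReal.rpow_mul, ← ENNReal.rpow_mul, ← ENNReal.rpow_mul, mul_one_div_cancel hr0.ne',
      ENNReal.rpow_one, show r / (2 * p) * (1 / r) = 1 / p * (1 / 2) by field_simp,
      show r / (2 * q) * (1 / r) = 1 / q * (1 / 2) by field_simp]
    push_cast
    gcongr
    calc (N : ℝ≥0∞) ^ (1 / r) ≤ (N + 1 : ℝ≥0∞) ^ (1 / r) := by gcongr; exact le_self_add
      _ ≤ (N + 1 : ℝ≥0∞) ^ (1 : ℝ) := by
        refine ENNReal.rpow_le_rpow_of_exponent_le le_add_self ?_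
        rw [div_le_one hr0]; exact hr
      _ = N + 1 := ENNReal.rpow_one _
  calc eLpNorm (fderiv ℝ v) (ENNReal.ofReal r) volume
      ≤ eLpNorm (∑ i, fun x => ‖fderiv ℝ v x (EuclideanSpace.single i 1)‖)
          (ENNReal.ofReal r) volume := by
        refine eLpNorm_mono_real fun x => ?_
        rw [Finset.sum_apply]
        exact norm_clm_le_sum_single _
    _ ≤ ∑ i, eLpNorm (fun x => ‖fderiv ℝ v x (EuclideanSpace.single i 1)‖)
          (ENNReal.ofReal r) volume :=
        eLpNorm_sum_le (fun i _ => (hcont _).norm.aestronglyMeasurable)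
          (ENNReal.one_le_ofReal.2 hr)
    _ ≤ ∑ i : Fin (n + 1), ((N + 1) * 5 : ℕ) * S := by
        refine Finset.sum_le_sum fun i _ => ?_
        rw [eLpNorm_norm]
        exact hdir i
    _ = _ := by
        simp only [Finset.sum_const, Finset.card_univ, Fintype.card_fin, nsmul_eq_mul]
        push_cast
        ring

lemma mul_le_of_midpoint_convex {M : ℕ → ℝ} {m : ℕ}
    (h : ∀ j, j + 2 ≤ m → 2 * M (j + 1) ≤ M j + M (j + 2)) {k : ℕ} (hk : 0 < k) (hkm : k ≤ m) :
    m * M k ≤ (m - k) * M 0 + k * M m := by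
  have hslope : ∀ j, j + 1 ≤ m → (j + 1) * (M j - M 0) ≤ j * (M (j + 1) - M 0) := by
    intro j
    induction j with
    | zero => intro _; simp
    | succ j ih =>
      intro hj
      have h1 := ih (by omega)
      have h2 := mul_le_mul_of_nonneg_left (h j hj) (by positivity : (0 : ℝ) ≤ j + 1)
      push_cast
      linarith
  have hmono : ∀ l, k ≤ l → l ≤ m → l * (M k - M 0) ≤ k * (M l - M 0) := by
    intro l hkl
    induction l, hkl using Nat.le_induction with
    | base => intro _; exact le_rfl
    | succ l hkl ih =>
      intro hl
      have hl0 : (0 : ℝ) < l := by exact_mod_cast hk.trans_le hkl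
      have h1 := mul_le_mul_of_nonneg_left (ih (by omega)) (by positivity : (0 : ℝ) ≤ l + 1)
      have h2 := mul_le_mul_of_nonneg_left (hslope l hl) (by positivity : (0 : ℝ) ≤ k)
      refine le_of_mul_le_mul_left ?_ hl0
      push_cast
      linarith
  linarith [hmono m hkm le_rfl]

lemma ne_zero_of_sq_le_mul {a : ℕ → ℝ} {m : ℕ} {K : ℝ}
    (h : ∀ j, j + 2 ≤ m → a (j + 1) ^ 2 ≤ K ^ 2 * (a j * a (j + 2))) {k : ℕ} (hk : 0 < k)
    (hkm : k < m) (hak : a k ≠ 0) {j : ℕ} (hj : j ≤ m) : a j ≠ 0 := by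
  have hstep : ∀ i, i + 2 ≤ m → a (i + 1) ≠ 0 → a i ≠ 0 ∧ a (i + 2) ≠ 0 := by
    intro i hi hai
    have h1 := h i hi
    have h2 : 0 < a (i + 1) ^ 2 := by positivity
    constructor <;> intro h0 <;> rw [h0] at h1 <;> linarith
  rcases le_total k j with hkj | hjk
  · induction j, hkj using Nat.le_induction with
    | base => exact hak
    | succ j hkj ih =>
      obtain ⟨i, rfl⟩ : ∃ i, j = i + 1 := ⟨j - 1, by omega⟩
      exact (hstep i (by omega) (ih (by omega))).2
  · induction hjk using Nat.decreasingInduction with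
    | self => exact hak
    | of_succ j hjk ih => exact (hstep j (by omega) (ih (by omega))).1

lemma le_rpow_mul_rpow_of_sq_le_mul {a : ℕ → ℝ} {m : ℕ} {K : ℝ} (ha : ∀ j, 0 ≤ a j) (hK : 1 ≤ K)
    (h : ∀ j, j + 2 ≤ m → a (j + 1) ^ 2 ≤ K ^ 2 * (a j * a (j + 2))) (hm : 0 < m)
    {k : ℕ} (hkm : k ≤ m) :
    a k ≤ K ^ (m ^ 2) * a 0 ^ (1 - (k : ℝ) / m) * a m ^ ((k : ℝ) / m) := by
  have hm' : (0 : ℝ) < m := by exact_mod_cast hm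
  have hKm : 1 ≤ K ^ (m ^ 2) := one_le_pow₀ hK
  rcases Nat.eq_zero_or_pos k with rfl | hk
  · simpa using le_mul_of_one_le_left (ha 0) hKm
  rcases hkm.eq_or_lt with rfl | hkm'
  · simpa [div_self hm'.ne'] using le_mul_of_one_le_left (ha k) hKm
  rcases eq_or_ne (a k) 0 with hak | hak
  · rw [hak]
    have := ha 0
    have := ha m
    positivity
  have hpos : ∀ j, j ≤ m → 0 < a j := fun j hj =>
    (ha j).lt_of_ne' (ne_zero_of_sq_le_mul h hk hkm' hak hj)
  have hK0 : 0 < K := by linarith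
  have hlogK : 0 ≤ Real.log K := Real.log_nonneg hK
  have hconv : ∀ j, j + 2 ≤ m → 2 * (Real.log (a (j + 1)) + Real.log K * ((j + 1 : ℕ) : ℝ) ^ 2) ≤
      (Real.log (a j) + Real.log K * (j : ℝ) ^ 2) +
      (Real.log (a (j + 2)) + Real.log K * ((j + 2 : ℕ) : ℝ) ^ 2) := by
    intro j hj
    have h0 := hpos j (by omega)
    have h1 := hpos (j + 1) (by omega)
    have h2 := hpos (j + 2) (by omega)
    have hlog := Real.log_le_log (by positivity) (h j hj)
    rw [Real.log_mul (by positivity) (by positivity), Real.log_mul h0.ne' h2.ne', Real.log_pow,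
      Real.log_pow] at hlog
    push_cast at hlog ⊢
    linarith
  have hmain := mul_le_of_midpoint_convex
    (M := fun j => Real.log (a j) + Real.log K * (j : ℝ) ^ 2) hconv hk hkm
  have h0 := hpos 0 (by omega)
  have h1 := hpos m le_rfl
  rw [← Real.log_le_log_iff (hpos k hkm) (by positivity),
    Real.log_mul (by positivity) (by positivity), Real.log_mul (by positivity) (by positivity),
    Real.log_rpow h0, Real.log_rpow h1, Real.log_pow]
  have hk0 : (0 : ℝ) ≤ k := by positivity
  have hkm1 : (k : ℝ) ≤ m := by exact_mod_cast hkm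
  have hbound : Real.log K * (k * (m - k)) ≤ Real.log K * m ^ 2 := by
    gcongr
    nlinarith
  refine le_of_mul_le_mul_left ?_ hm'
  have hb := mul_le_mul_of_nonneg_left hbound hm'.le
  have e : (m : ℝ) * (((m ^ 2 : ℕ) : ℝ) * Real.log K + (1 - (k : ℝ) / m) * Real.log (a 0) +
      (k : ℝ) / m * Real.log (a m)) = m * (Real.log K * m ^ 2) + (m - k) * Real.log (a 0) +
      k * Real.log (a m) := by
    push_cast
    field_simp
  rw [e]
  simp only [Nat.cast_zero] at hmain
  linarith

set_option maxSynthPendingDepth 3 in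
lemma norm_fderiv_fderiv_iteratedFDeriv {E F : Type*} [NormedAddCommGroup E] [NormedSpace ℝ E]
    [NormedAddCommGroup F] [NormedSpace ℝ F] (u : E → F) (k : ℕ) (x : E) :
    ‖fderiv ℝ (fderiv ℝ (iteratedFDeriv ℝ k u)) x‖ = ‖iteratedFDeriv ℝ (k + 2) u x‖ := by
  rw [fderiv_iteratedFDeriv, LinearIsometryEquiv.comp_fderiv, ← norm_fderiv_iteratedFDeriv]
  exact LinearIsometry.norm_toContinuousLinearMap_comp
    (continuousMultilinearCurryLeftEquiv ℝ (fun _ : Fin (k + 1) => E) F).toLinearIsometry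

set_option maxSynthPendingDepth 3 in
set_option maxHeartbeats 1000000 in
lemma dLpN_sq_le {N : ℕ} {τ : ℝ} (hτ : 1 < τ)
    (hN : IsEmpty (Besicovitch.SatelliteConfig ℝ N τ)) {n : ℕ}
    {u : EuclideanSpace ℝ (Fin (n + 1)) → ℝ} (hu : ContDiff ℝ (⊤ : ℕ∞) u)
    (hs : HasCompactSupport u) (k : ℕ) {p q r : ℝ} (hp : 1 ≤ p) (hq : 1 ≤ q) (hr : 1 ≤ r)
    (hpqr : r / (2 * p) + r / (2 * q) = 1) :
    dLpN (n + 1) (k + 1) r u ^ 2 ≤ (((n + 1) * ((N + 1) * 5) : ℕ) : ℝ) ^ 2 *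
      (dLpN (n + 1) k p u * dLpN (n + 1) (k + 2) q u) := by
  have hv : ContDiff ℝ 2 (iteratedFDeriv ℝ k u) :=
    (contDiff_infty.1 hu (2 + k)).iteratedFDeriv_right (by push_cast; exact le_rfl)
  have h := eLpNorm_fderiv_le_interpolate hτ hN hv (hs.iteratedFDeriv k) hp hq hr hpqr
  have e0 : ∀ s, eLpNorm (iteratedFDeriv ℝ k u) (ENNReal.ofReal s) volume =
      eLpNorm (fun x => ‖iteratedFDeriv ℝ k u x‖) (ENNReal.ofReal s) volume := fun s =>
    (eLpNorm_norm _).symm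
  have e1 : ∀ s, eLpNorm (fderiv ℝ (iteratedFDeriv ℝ k u)) (ENNReal.ofReal s) volume =
      eLpNorm (fun x => ‖iteratedFDeriv ℝ (k + 1) u x‖) (ENNReal.ofReal s) volume := fun s =>
    eLpNorm_congr_norm_ae (.of_forall fun x => by rw [norm_norm, norm_fderiv_iteratedFDeriv])
  have e2 : ∀ s, eLpNorm (fderiv ℝ (fderiv ℝ (iteratedFDeriv ℝ k u))) (ENNReal.ofReal s) volume =
      eLpNorm (fun x => ‖iteratedFDeriv ℝ (k + 2) u x‖) (ENNReal.ofReal s) volume := fun s =>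
    eLpNorm_congr_norm_ae (.of_forall fun x => by
      rw [norm_norm, norm_fderiv_fderiv_iteratedFDeriv])
  have hfin : ∀ (j : ℕ) (s : ℝ),
      eLpNorm (fun x => ‖iteratedFDeriv ℝ j u x‖) (ENNReal.ofReal s) volume ≠ ∞ := fun j s =>
    ((hu.continuous_iteratedFDeriv
      (by exact_mod_cast (le_top : (j : ℕ∞) ≤ ⊤))).memLp_of_hasCompactSupport
      (hs.iteratedFDeriv j)).norm.eLpNorm_ne_top
  rw [e0, e1, e2] at h
  have h' := ENNReal.toReal_mono (by
    exact ENNReal.mul_ne_top (ENNReal.natCast_ne_top _) (ENNReal.mul_ne_top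
      (ENNReal.rpow_ne_top_of_nonneg (by norm_num) (hfin _ _))
      (ENNReal.rpow_ne_top_of_nonneg (by norm_num) (hfin _ _)))) h
  rw [ENNReal.toReal_mul, ENNReal.toReal_mul, ← ENNReal.toReal_rpow, ← ENNReal.toReal_rpow,
    ENNReal.toReal_natCast, ← Real.sqrt_eq_rpow, ← Real.sqrt_eq_rpow] at h'
  unfold dLpN
  refine (pow_le_pow_left₀ ENNReal.toReal_nonneg h' 2).trans (le_of_eq ?_)
  rw [mul_pow, mul_pow, Real.sq_sqrt ENNReal.toReal_nonneg, Real.sq_sqrt ENNReal.toReal_nonneg]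

theorem stmt15 (n : ℕ) (hn : 1 ≤ n) (m : ℕ) (hm : 0 < m) (α β : ℝ)
    (hα : 0 < α ∧ α ≤ 1) (hβ : 0 < β ∧ β ≤ 1) :
    ∃ C : ℝ, ∀ u : EuclideanSpace ℝ (Fin n) → ℝ, ContDiff ℝ (⊤ : ℕ∞) u → HasCompactSupport u →
      ∀ k : ℕ, k ≤ m →
        dLpN n k (1 / ((1 - (k : ℝ) / m) * α + ((k : ℝ) / m) * β)) u ≤
          C * (lpN n (1 / α) u) ^ (1 - (k : ℝ) / m) *
            (dLpN n m (1 / β) u) ^ ((k : ℝ) / m) := by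
  obtain ⟨n, rfl⟩ : ∃ l, n = l + 1 := ⟨n - 1, by omega⟩
  obtain ⟨N, τ, hτ, hN⟩ := HasBesicovitchCovering.no_satelliteConfig (α := ℝ)
  have hm' : (0 : ℝ) < m := by exact_mod_cast hm
  refine ⟨(((n + 1) * ((N + 1) * 5) : ℕ) : ℝ) ^ (m ^ 2), fun u hu hs k hk => ?_⟩
  set γ : ℕ → ℝ := fun j => (1 - (j : ℝ) / m) * α + ((j : ℝ) / m) * β with hγ
  have hγ01 : ∀ j ≤ m, 0 < γ j ∧ γ j ≤ 1 := by
    intro j hj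
    have h0 : 0 ≤ (j : ℝ) / m := by positivity
    have h1 : (j : ℝ) / m ≤ 1 := by
      rw [div_le_one hm']
      exact_mod_cast hj
    constructor
    · rcases h0.eq_or_lt with h | h
      · simp [hγ, ← h, hα.1]
      · exact add_pos_of_nonneg_of_pos (mul_nonneg (by linarith) hα.1.le) (mul_pos h hβ.1)
    · have h2 := mul_le_mul_of_nonneg_left hα.2 (sub_nonneg.2 h1)
      have h3 := mul_le_mul_of_nonneg_left hβ.2 h0
      simp only [hγ]
      linarith
  have hinv : ∀ j ≤ m, 1 ≤ 1 / γ j := fun j hj => by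
    rw [le_div_iff₀ (hγ01 j hj).1, one_mul]
    exact (hγ01 j hj).2
  have hmid : ∀ j, γ j + γ (j + 2) = 2 * γ (j + 1) := fun j => by
    simp only [hγ]
    push_cast
    ring
  have h := le_rpow_mul_rpow_of_sq_le_mul (a := fun j => dLpN (n + 1) j (1 / γ j) u) (m := m)
    (K := (((n + 1) * ((N + 1) * 5) : ℕ) : ℝ)) (fun j => ENNReal.toReal_nonneg)
    (by exact_mod_cast Nat.succ_le_of_lt (by positivity)) (fun j hj => by
      refine dLpN_sq_le hτ hN hu hs j (hinv j (by omega)) (hinv (j + 2) hj)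
        (hinv (j + 1) (by omega)) ?_
      have h0 := (hγ01 j (by omega)).1
      have h1 := (hγ01 (j + 1) (by omega)).1
      have h2 := (hγ01 (j + 2) hj).1
      have := hmid j
      field_simp
      linarith) hm hk
  have hγ0 : γ 0 = α := by simp [hγ]
  have hγm : γ m = β := by simp [hγ, div_self hm'.ne']
  have hzero : dLpN (n + 1) 0 (1 / α) u = lpN (n + 1) (1 / α) u := by
    unfold dLpN lpN
    simp only [norm_iteratedFDeriv_zero, eLpNorm_norm]
  simp only [hγ0, hγm, hzero] at h
  exact h
end
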